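/- arXiv:1302.4212 — 3 statements merged into one kernel-verified Lean document; each statement's English description precedes it below -/
import Mathlib

section
/- Let ε ≥ 0 and let Φ, F, G : [0,∞) → ℝ be differentiable functions satisfying Φ'(r) = 2 r G(r) and G'(r) = 2 r F(r) for all r ≥ 0, and suppose |F'(r)| ≤ 2 ε r for all r ≥ 0. Then for every r ≥ 0, |Φ(r)| ≤ (ε/6) r⁶ + (|F(0)|/2) r⁴ + |G(0)| r² + |Φ(0)|. -/
open Set

theorem abs_le_of_abs_derivWithin_Ici_le {f f' B B' : ℝ → ℝ}
    (hf : ∀ r ∈ Ici (0 : ℝ), HasDerivWithinAt f (f' r) (Ici 0) r)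
    (hB : ∀ r, HasDerivAt B (B' r) r) (h₀ : |f 0| ≤ B 0)
    (hbound : ∀ r ∈ Ici (0 : ℝ), |f' r| ≤ B' r) :
    ∀ r ∈ Ici (0 : ℝ), |f r| ≤ B r := fun r hr =>
  image_norm_le_of_norm_deriv_right_le_deriv_boundary (a := 0) (b := r)
    (fun x hx => (hf x hx.1).continuousWithinAt.mono Icc_subset_Ici_self)
    (fun x hx => (hf x hx.1).mono (Ici_subset_Ici.2 hx.1)) h₀ hB
    (fun x hx => hbound x hx.1) ⟨hr, le_rfl⟩

theorem hasDerivAt_even_sextic (a b c d r : ℝ) :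
    HasDerivAt (fun x : ℝ => a / 6 * x ^ 6 + b / 2 * x ^ 4 + c * x ^ 2 + d)
      (2 * r * (a / 2 * r ^ 4 + b * r ^ 2 + c)) r := by
  refine (((((hasDerivAt_pow 6 r).const_mul (a / 6)).add
    ((hasDerivAt_pow 4 r).const_mul (b / 2))).add
    ((hasDerivAt_pow 2 r).const_mul c)).add_const d).congr_deriv ?_
  push_cast
  ring

theorem abs_le_even_sextic {f g : ℝ → ℝ} {a b c : ℝ}
    (hf : ∀ r ∈ Ici (0 : ℝ), HasDerivWithinAt f (2 * r * g r) (Ici 0) r)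
    (hg : ∀ r ∈ Ici (0 : ℝ), |g r| ≤ a / 2 * r ^ 4 + b * r ^ 2 + c) :
    ∀ r ∈ Ici (0 : ℝ), |f r| ≤ a / 6 * r ^ 6 + b / 2 * r ^ 4 + c * r ^ 2 + |f 0| := by
  refine abs_le_of_abs_derivWithin_Ici_le hf (hasDerivAt_even_sextic a b c _) (by simp)
    fun r hr => ?_
  have hr' : 0 ≤ 2 * r := mul_nonneg zero_le_two hr
  rw [abs_mul, abs_of_nonneg hr']
  exact mul_le_mul_of_nonneg_left (hg r hr) hr'

/-- Let `ε ≥ 0` and let `Φ, F, G : [0,∞) → ℝ` be differentiable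
functions satisfying `Φ' r = 2 r G r` and `G' r = 2 r F r` for all `r ≥ 0`, and suppose
`|F' r| ≤ 2 ε r` for all `r ≥ 0`.  Then for every `r ≥ 0`,
`|Φ r| ≤ (ε/6) r⁶ + (|F 0|/2) r⁴ + |G 0| r² + |Φ 0|`. -/
theorem kahler_potential_estimate (ε : ℝ) (hε : 0 ≤ ε) (Φ F G F' : ℝ → ℝ)
    (hΦ : ∀ r ∈ Ici (0 : ℝ), HasDerivWithinAt Φ (2 * r * G r) (Ici 0) r)
    (hG : ∀ r ∈ Ici (0 : ℝ), HasDerivWithinAt G (2 * r * F r) (Ici 0) r)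
    (hF : ∀ r ∈ Ici (0 : ℝ), HasDerivWithinAt F (F' r) (Ici 0) r)
    (hF' : ∀ r ∈ Ici (0 : ℝ), |F' r| ≤ 2 * ε * r) :
    ∀ r ∈ Ici (0 : ℝ),
      |Φ r| ≤ ε / 6 * r ^ 6 + |F 0| / 2 * r ^ 4 + |G 0| * r ^ 2 + |Φ 0| := by
  have hF_bound : ∀ r ∈ Ici (0 : ℝ), |F r| ≤ ε * r ^ 2 + |F 0| := by
    refine abs_le_of_abs_derivWithin_Ici_le hF (B' := fun r => 2 * ε * r) (fun r => ?_)
      (by simp) hF'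
    refine (((hasDerivAt_pow 2 r).const_mul ε).add_const |F 0|).congr_deriv ?_
    push_cast
    ring
  have hG_bound : ∀ r ∈ Ici (0 : ℝ), |G r| ≤ ε / 2 * r ^ 4 + |F 0| * r ^ 2 + |G 0| := by
    simpa using abs_le_even_sextic (a := 0) hG (by simpa using hF_bound)
  exact abs_le_even_sextic hΦ hG_bound
end

section
/- Let ρ : ℝ³ → ℝ be smooth with compact support, and define u : ℝ³ → ℝ by u(x) = −(1/(4π)) ∫_{ℝ³} ρ(y)/‖x−y‖ dy. Then u is differentiable on ℝ³ and for every x ∈ ℝ³ its gradient is given by ∇u(x) = (1/(4π)) ∫_{ℝ³} ((x−y)/‖x−y‖³) ρ(y) dy. -/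
open MeasureTheory

open Filter Topology Module

/-- A power `‖x‖⁻ˢ` with `s` below the dimension is locally integrable. -/
lemma locallyIntegrable_norm_pow_inv {E : Type*} [NormedAddCommGroup E] [NormedSpace ℝ E]
    [FiniteDimensional ℝ E] [MeasurableSpace E] [BorelSpace E] (μ : Measure E)
    [μ.IsAddHaarMeasure] {s : ℕ} (hs : s < finrank ℝ E) :
    LocallyIntegrable (fun x : E => (‖x‖ ^ s)⁻¹) μ := by
  have : Nontrivial E := Module.nontrivial_of_finrank_pos (R := ℝ) (by omega)
  have : ProperSpace E := FiniteDimensional.proper ℝ E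
  rw [locallyIntegrable_iff]
  intro k hk
  obtain ⟨r, hr⟩ := hk.isBounded.subset_ball (0 : E)
  refine IntegrableOn.mono_set ?_ hr
  rw [integrableOn_fun_norm_addHaar μ (f := fun y => (y ^ s)⁻¹)]
  have hc : IntegrableOn (fun y : ℝ => y ^ (finrank ℝ E - 1 - s)) (Set.Ioo 0 r) :=
    ((continuous_pow _).integrableOn_Icc).mono_set Set.Ioo_subset_Icc_self
  refine hc.congr_fun (fun y hy => ?_) measurableSet_Ioo
  have hy0 : y ≠ 0 := hy.1.ne'
  simp only [smul_eq_mul]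
  rw [pow_sub₀ y hy0 (by omega)]

lemma norm_le_sqrt_norm_sq_add {E : Type*} [NormedAddCommGroup E] {a : ℝ} (ha : 0 ≤ a) (t : E) :
    ‖t‖ ≤ √(‖t‖ ^ 2 + a) :=
  Real.le_sqrt_of_sq_le (by linarith)

lemma tendsto_sqrt_norm_sq_add {E : Type*} [NormedAddCommGroup E] (t : E) :
    Tendsto (fun a : ℝ => √(‖t‖ ^ 2 + a)) (𝓝[>] 0) (𝓝 ‖t‖) := by
  have : Continuous (fun a : ℝ => √(‖t‖ ^ 2 + a)) := by fun_prop
  simpa using (this.tendsto 0).mono_left nhdsWithin_le_nhds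

section Regularization

variable {E : Type*} [NormedAddCommGroup E] [InnerProductSpace ℝ E]

lemma hasFDerivAt_inv_sqrt_norm_sq_add {a : ℝ} (ha : 0 < a) (t : E) :
    HasFDerivAt (fun t : E => (√(‖t‖ ^ 2 + a))⁻¹)
      (-(√(‖t‖ ^ 2 + a) ^ 3)⁻¹ • innerSL ℝ t) t := by
  have hpos : 0 < ‖t‖ ^ 2 + a := by positivity
  have h1 : HasFDerivAt (fun t : E => ‖t‖ ^ 2 + a) (2 • innerSL ℝ t) t :=
    (hasStrictFDerivAt_norm_sq t).hasFDerivAt.add_const a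
  have h2 := ((Real.hasDerivAt_sqrt hpos.ne').inv (Real.sqrt_pos.2 hpos).ne').comp_hasFDerivAt t h1
  refine h2.congr_fderiv ?_
  have hs : √(‖t‖ ^ 2 + a) ≠ 0 := (Real.sqrt_pos.2 hpos).ne'
  ext v
  simp
  field_simp

/-- Integration by parts against the regularized kernel. -/
lemma integral_mul_regularized_kernel [FiniteDimensional ℝ E] [MeasurableSpace E] [BorelSpace E]
    (μ : Measure E) [μ.IsAddHaarMeasure] {f : E → ℝ} (hf : ContDiff ℝ 1 f)
    (hs : HasCompactSupport f) {a : ℝ} (ha : 0 < a) (v : E) :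
    ∫ t, f t * ((√(‖t‖ ^ 2 + a) ^ 3)⁻¹ * inner ℝ t v) ∂μ
      = ∫ t, fderiv ℝ f t v * (√(‖t‖ ^ 2 + a))⁻¹ ∂μ := by
  have hpos (t : E) : √(‖t‖ ^ 2 + a) ≠ 0 := (Real.sqrt_pos.2 (by positivity)).ne'
  have hK : Continuous (fun t : E => (√(‖t‖ ^ 2 + a))⁻¹) :=
    Continuous.inv₀ (by fun_prop) hpos
  have hK' : Continuous (fun t : E => -((√(‖t‖ ^ 2 + a) ^ 3)⁻¹ * inner ℝ t v)) :=
    ((Continuous.inv₀ (by fun_prop) (fun t => pow_ne_zero 3 (hpos t))).mul (by fun_prop)).neg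
  have hfd (t : E) : fderiv ℝ (fun t : E => (√(‖t‖ ^ 2 + a))⁻¹) t v
      = -((√(‖t‖ ^ 2 + a) ^ 3)⁻¹ * inner ℝ t v) := by
    rw [(hasFDerivAt_inv_sqrt_norm_sq_add ha t).fderiv]
    simp
  have hf' : Continuous (fun t => fderiv ℝ f t v) :=
    (hf.continuous_fderiv one_ne_zero).clm_apply continuous_const
  have key := integral_mul_fderiv_eq_neg_fderiv_mul_of_integrable (μ := μ) (f := f)
    (g := fun t : E => (√(‖t‖ ^ 2 + a))⁻¹) (v := v)
    ((hf'.mul hK).integrable_of_hasCompactSupport ((hs.fderiv_apply ℝ v).mul_right))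
    (by simp only [hfd]
        exact (hf.continuous.mul hK').integrable_of_hasCompactSupport hs.mul_right)
    ((hf.continuous.mul hK).integrable_of_hasCompactSupport hs.mul_right)
    (fun t _ => hf.differentiable one_ne_zero t)
    (fun t _ => (hasFDerivAt_inv_sqrt_norm_sq_add ha t).differentiableAt)
  simpa only [hfd, mul_neg, integral_neg, neg_inj] using key

/-- Integration by parts against the singular kernel `‖t‖⁻¹` in dimension at least three. -/
lemma integral_mul_norm_inv_kernel [FiniteDimensional ℝ E] [MeasurableSpace E] [BorelSpace E]
    (μ : Measure E) [μ.IsAddHaarMeasure] (hd : 2 < finrank ℝ E) {f : E → ℝ}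
    (hf : ContDiff ℝ 1 f) (hs : HasCompactSupport f) (v : E) :
    ∫ t, f t * ((‖t‖ ^ 3)⁻¹ * inner ℝ t v) ∂μ = ∫ t, fderiv ℝ f t v * ‖t‖⁻¹ ∂μ := by
  have : Nontrivial E := Module.nontrivial_of_finrank_pos (R := ℝ) (by omega)
  have hne : ∀ᵐ t ∂μ, t ≠ (0 : E) := by simp [ae_iff]
  have hf' : Continuous (fun t => fderiv ℝ f t v) :=
    (hf.continuous_fderiv one_ne_zero).clm_apply continuous_const
  have hs' : HasCompactSupport (fun t => fderiv ℝ f t v) := hs.fderiv_apply ℝ v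
  have hpos {a : ℝ} (ha : 0 < a) (t : E) : 0 < √(‖t‖ ^ 2 + a) := Real.sqrt_pos.2 (by positivity)
  have h1 : Tendsto (fun a : ℝ => ∫ t, fderiv ℝ f t v * (√(‖t‖ ^ 2 + a))⁻¹ ∂μ) (𝓝[>] 0)
      (𝓝 (∫ t, fderiv ℝ f t v * ‖t‖⁻¹ ∂μ)) := by
    refine tendsto_integral_filter_of_dominated_convergence
      (fun t => ‖fderiv ℝ f t v‖ * (‖t‖ ^ 1)⁻¹) ?_ ?_ ?_ ?_
    · filter_upwards [self_mem_nhdsWithin] with a ha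
      exact (hf'.mul (Continuous.inv₀ (by fun_prop)
        (fun t => (hpos ha t).ne'))).aestronglyMeasurable
    · filter_upwards [self_mem_nhdsWithin] with a ha
      filter_upwards [hne] with t ht
      rw [norm_mul, norm_inv, Real.norm_of_nonneg (Real.sqrt_nonneg _), pow_one]
      have := norm_pos_iff.2 ht
      gcongr
      exact norm_le_sqrt_norm_sq_add (le_of_lt ha) t
    · exact (locallyIntegrable_norm_pow_inv μ (by omega)).integrable_smul_left_of_hasCompactSupport
        hf'.norm hs'.norm
    · filter_upwards [hne] with t ht
      exact ((tendsto_sqrt_norm_sq_add t).inv₀ (norm_ne_zero_iff.2 ht)).const_mul _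
  have h2 : Tendsto (fun a : ℝ => ∫ t, f t * ((√(‖t‖ ^ 2 + a) ^ 3)⁻¹ * inner ℝ t v) ∂μ) (𝓝[>] 0)
      (𝓝 (∫ t, f t * ((‖t‖ ^ 3)⁻¹ * inner ℝ t v) ∂μ)) := by
    refine tendsto_integral_filter_of_dominated_convergence
      (fun t => (‖f t‖ * ‖v‖) * (‖t‖ ^ 2)⁻¹) ?_ ?_ ?_ ?_
    · filter_upwards [self_mem_nhdsWithin] with a ha
      exact (hf.continuous.mul ((Continuous.inv₀ (by fun_prop)
        (fun t => pow_ne_zero 3 (hpos ha t).ne')).mul (by fun_prop))).aestronglyMeasurable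
    · filter_upwards [self_mem_nhdsWithin] with a ha
      filter_upwards [hne] with t ht
      have ht0 := norm_pos_iff.2 ht
      rw [norm_mul, norm_mul, norm_inv, norm_pow, Real.norm_of_nonneg (Real.sqrt_nonneg _)]
      calc ‖f t‖ * ((√(‖t‖ ^ 2 + a) ^ 3)⁻¹ * ‖inner ℝ t v‖)
          ≤ ‖f t‖ * ((‖t‖ ^ 3)⁻¹ * (‖t‖ * ‖v‖)) := by
            gcongr
            · exact norm_le_sqrt_norm_sq_add (le_of_lt ha) t
            · exact norm_inner_le_norm t v
        _ = (‖f t‖ * ‖v‖) * (‖t‖ ^ 2)⁻¹ := by field_simp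
    · exact (locallyIntegrable_norm_pow_inv μ hd).integrable_smul_left_of_hasCompactSupport
        (hf.continuous.norm.mul continuous_const) hs.norm.mul_right
    · filter_upwards [hne] with t ht
      exact ((((tendsto_sqrt_norm_sq_add t).pow 3).inv₀
        (pow_ne_zero 3 (norm_ne_zero_iff.2 ht))).mul_const _).const_mul _
  refine tendsto_nhds_unique h2 (h1.congr' ?_)
  filter_upwards [self_mem_nhdsWithin] with a ha
  exact (integral_mul_regularized_kernel μ hf hs ha v).symm

end Regularization

/-- (The paper's Lemma 1.)  Let `ρ : ℝ³ → ℝ` be smooth with compact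
support and let `u x = −(1/(4π)) ∫ ρ y / ‖x − y‖ dy` be its Coulomb potential.  Then `u`
is differentiable and its gradient is `∇u x = (1/(4π)) ∫ ((x−y)/‖x−y‖³) ρ y dy`. -/
theorem coulomb_potential_gradient (ρ : EuclideanSpace ℝ (Fin 3) → ℝ)
    (hρ : ContDiff ℝ (⊤ : ℕ∞) ρ) (hsupp : HasCompactSupport ρ) :
    ∀ x : EuclideanSpace ℝ (Fin 3),
      HasGradientAt
        (fun x : EuclideanSpace ℝ (Fin 3) => -(1 / (4 * Real.pi)) * ∫ y, ρ y / ‖x - y‖)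
        ((1 / (4 * Real.pi)) • ∫ y, ρ y • ((‖x - y‖ ^ 3)⁻¹ • (x - y))) x := by
  intro x
  have hd : finrank ℝ (EuclideanSpace ℝ (Fin 3)) = 3 := by simp
  have hρ1 : ContDiff ℝ 1 ρ := hρ.of_le (by exact_mod_cast le_top)
  have hK : LocallyIntegrable (fun t : EuclideanSpace ℝ (Fin 3) => ‖t‖⁻¹) volume := by
    simpa using locallyIntegrable_norm_pow_inv
      (volume : Measure (EuclideanSpace ℝ (Fin 3))) (s := 1) (by omega)
  have hK2 := locallyIntegrable_norm_pow_inv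
    (volume : Measure (EuclideanSpace ℝ (Fin 3))) (s := 2) (by omega)
  have hconv := hsupp.hasFDerivAt_convolution_right (ContinuousLinearMap.mul ℝ ℝ) hK hρ1 x
  have hfun (z : EuclideanSpace ℝ (Fin 3)) :
      convolution (fun t => ‖t‖⁻¹) ρ (ContinuousLinearMap.mul ℝ ℝ) volume z
        = ∫ y, ρ y / ‖z - y‖ := by
    rw [convolution_def, ← integral_sub_left_eq_self (fun y => ρ y / ‖z - y‖) volume z]
    simp [div_eq_inv_mul]
  rw [hasGradientAt_iff_hasFDerivAt]
  simp only [← hfun]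
  refine (hconv.const_mul (-(1 / (4 * Real.pi)))).congr_fderiv ?_
  have hcd : ContDiff ℝ 1 (fun t => ρ (x - t)) := hρ1.comp (contDiff_const.sub contDiff_id)
  have hcs : HasCompactSupport (fun t => ρ (x - t)) :=
    hsupp.comp_homeomorph (Homeomorph.subLeft x)
  have hint : Integrable
      (fun t : EuclideanSpace ℝ (Fin 3) => ρ (x - t) • ((‖t‖ ^ 3)⁻¹ • t)) := by
    refine (hK2.integrable_smul_left_of_hasCompactSupport hcd.continuous hcs).mono
      (hcd.continuous.aestronglyMeasurable.smul
        (Measurable.aestronglyMeasurable (by fun_prop))) ?_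
    refine Eventually.of_forall fun t => ?_
    rcases eq_or_ne t 0 with rfl | ht
    · simp
    · have := norm_pos_iff.2 ht
      simp only [norm_smul, norm_inv, norm_pow, norm_norm]
      apply le_of_eq
      field_simp
  ext v
  rw [smul_apply,
    convolution_precompR_apply _ hK (hsupp.fderiv ℝ) (hρ1.continuous_fderiv one_ne_zero),
    convolution_def, ← integral_sub_left_eq_self
      (fun y => ρ y • ((‖x - y‖ ^ 3)⁻¹ • (x - y))) volume x]
  simp only [sub_sub_cancel, InnerProductSpace.toDual_apply_apply, inner_smul_left]
  rw [real_inner_comm, ← integral_inner hint]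
  have key := integral_mul_norm_inv_kernel volume (by omega) hcd hcs v
  have hfd (t : EuclideanSpace ℝ (Fin 3)) :
      fderiv ℝ (fun t => ρ (x - t)) t v = -(fderiv ℝ ρ (x - t) v) := by
    have h := ((hρ1.differentiable one_ne_zero (x - t)).hasFDerivAt).comp t
      ((hasFDerivAt_id t).const_sub x)
    rw [show (fun t => ρ (x - t)) = ρ ∘ (x - ·) from rfl, h.fderiv]
    simp
  simp only [hfd] at key
  simp only [real_inner_comm _ v, real_inner_smul_left]
  rw [key]
  simp [integral_neg, mul_comm]
end

section
/- Let ρ : ℝ³ → ℝ be smooth with compact support, and define u : ℝ³ → ℝ by u(x) = −(1/(4π)) ∫_{ℝ³} ρ(y)/‖x−y‖ dy. Then u is twice differentiable and satisfies the Poisson equation Δu(x) = Σ_{s=1}^{3} ∂²u/∂x_s²(x) = ρ(x) for every x ∈ ℝ³. -/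
open MeasureTheory Filter Topology Module

/-- The derivative of `x ↦ (1 + a ‖x‖²) ^ p` in the direction `v`. -/
lemma hasFDerivAt_one_add_mul_norm_sq_rpow {E : Type*} [NormedAddCommGroup E]
    [InnerProductSpace ℝ E] {a : ℝ} (ha : 0 ≤ a) (p : ℝ) (x : E) :
    HasFDerivAt (fun x : E => (1 + a * ‖x‖ ^ 2) ^ p)
      ((2 * a * p * (1 + a * ‖x‖ ^ 2) ^ (p - 1)) • innerSL ℝ x) x := by
  have hw : HasFDerivAt (fun x : E => 1 + a * ‖x‖ ^ 2) (a • (2 • innerSL ℝ x)) x :=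
    ((hasStrictFDerivAt_norm_sq x).hasFDerivAt.const_mul a).const_add 1
  have hpos : 1 + a * ‖x‖ ^ 2 ≠ 0 := by positivity
  convert! hw.rpow_const (p := p) (Or.inl hpos) using 1
  ext v
  simp
  ring

/-- The improper integral `∫₀^∞ t² (1 + t²) ^ (-5/2) dt = 1/3`. -/
lemma integral_Ioi_sq_mul_one_add_sq_rpow :
    ∫ t in Set.Ioi (0 : ℝ), t ^ 2 * (1 + t ^ 2) ^ (-5 / 2 : ℝ) = 1 / 3 := by
  have hderiv : ∀ t : ℝ, HasDerivAt (fun t : ℝ => t ^ 3 / 3 * (1 + t ^ 2) ^ (-3 / 2 : ℝ))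
      (t ^ 2 * (1 + t ^ 2) ^ (-5 / 2 : ℝ)) t := by
    intro t
    have hpos : 0 < 1 + t ^ 2 := by positivity
    have h1 : HasDerivAt (fun t : ℝ => 1 + t ^ 2) (2 * t) t := by
      simpa using (hasDerivAt_pow 2 t).const_add 1
    have h2 : HasDerivAt (fun t : ℝ => t ^ 3 / 3) (t ^ 2) t := by
      convert! (hasDerivAt_pow 3 t).div_const 3 using 1
      norm_num
    convert! h2.mul (h1.rpow_const (p := (-3 / 2 : ℝ)) (Or.inl hpos.ne')) using 1
    rw [show (-3 / 2 : ℝ) - 1 = -5 / 2 by norm_num,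
      show (-3 / 2 : ℝ) = -5 / 2 + 1 by norm_num, Real.rpow_add_one hpos.ne']
    ring
  have hlim : Tendsto (fun t : ℝ => t ^ 3 / 3 * (1 + t ^ 2) ^ (-3 / 2 : ℝ)) atTop (𝓝 (1 / 3)) := by
    have h0 : Tendsto (fun t : ℝ => (1 + t ^ 2)⁻¹) atTop (𝓝 0) :=
      tendsto_inv_atTop_zero.comp
        (tendsto_atTop_add_const_left _ _ (tendsto_pow_atTop two_ne_zero))
    have h1 : Tendsto (fun t : ℝ => (1 / 3) * (1 - (1 + t ^ 2)⁻¹) ^ (3 / 2 : ℝ)) atTop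
        (𝓝 ((1 / 3) * (1 - 0) ^ (3 / 2 : ℝ))) :=
      ((h0.const_sub 1).rpow_const (Or.inr (by norm_num))).const_mul _
    rw [sub_zero, Real.one_rpow, mul_one] at h1
    refine h1.congr' ?_
    filter_upwards [eventually_gt_atTop 0] with t ht
    have hpos : 0 < 1 + t ^ 2 := by positivity
    rw [show 1 - (1 + t ^ 2)⁻¹ = t ^ 2 * (1 + t ^ 2)⁻¹ by field_simp; ring,
      Real.mul_rpow (by positivity) (by positivity), Real.inv_rpow hpos.le,
      ← Real.rpow_neg hpos.le, ← Real.rpow_natCast t 2, ← Real.rpow_mul ht.le,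
      ← Real.rpow_natCast t 3]
    norm_num
    ring
  rw [integral_Ioi_of_hasDerivAt_of_nonneg' (fun t _ => hderiv t)
    (fun t _ => by positivity) hlim]
  simp

/-- The integral of `(1 + ‖x‖²) ^ (-5/2)` over `ℝ³` is `4π/3`. -/
lemma integral_one_add_norm_sq_rpow_euclidean_three :
    ∫ x : EuclideanSpace ℝ (Fin 3), (1 + ‖x‖ ^ 2) ^ (-5 / 2 : ℝ) = 4 * Real.pi / 3 := by
  rw [integral_fun_norm_addHaar volume (fun t : ℝ => (1 + t ^ 2) ^ (-5 / 2 : ℝ))]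
  simp only [finrank_euclideanSpace, Fintype.card_fin, Nat.add_one_sub_one, smul_eq_mul,
    integral_Ioi_sq_mul_one_add_sq_rpow, Measure.real, EuclideanSpace.volume_ball_fin_three]
  rw [ENNReal.toReal_mul, ENNReal.toReal_pow, ENNReal.toReal_ofReal zero_le_one,
    ENNReal.toReal_ofReal (by positivity)]
  simp
  ring

/-- The Newtonian kernel is locally integrable on `ℝ³`. -/
lemma locallyIntegrable_inv_norm_euclidean_three :
    LocallyIntegrable (fun x : EuclideanSpace ℝ (Fin 3) => ‖x‖⁻¹) := by
  have hball : ∀ r : ℝ,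
      IntegrableOn (fun x : EuclideanSpace ℝ (Fin 3) => ‖x‖⁻¹) (Metric.ball 0 r) := by
    intro r
    rw [integrableOn_fun_norm_addHaar volume (f := fun t : ℝ => t⁻¹)]
    have hid : IntegrableOn (fun t : ℝ => t) (Set.Ioo 0 r) :=
      (continuous_id.integrableOn_Icc).mono_set Set.Ioo_subset_Icc_self
    refine hid.congr_fun (fun t ht => ?_) measurableSet_Ioo
    have := ht.1.ne'
    simp
    field_simp
  intro x
  exact ⟨Metric.ball 0 (‖x‖ + 1), Metric.isOpen_ball.mem_nhds (by simp), hball _⟩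

/-- Convolution of a smooth compactly supported function with the Newtonian kernel is smooth. -/
lemma contDiff_integral_div_norm {f : EuclideanSpace ℝ (Fin 3) → ℝ}
    (hf : ContDiff ℝ (⊤ : ℕ∞) f) (hfc : HasCompactSupport f) :
    ContDiff ℝ (⊤ : ℕ∞) (fun x => ∫ y, f y / ‖x - y‖) := by
  exact hfc.contDiff_convolution_left (μ := volume) (ContinuousLinearMap.mul ℝ ℝ) hf
    locallyIntegrable_inv_norm_euclidean_three

/-- Derivatives of a Newtonian potential fall on the density. -/
lemma fderiv_integral_div_norm {f : EuclideanSpace ℝ (Fin 3) → ℝ}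
    (hf : ContDiff ℝ (⊤ : ℕ∞) f) (hfc : HasCompactSupport f)
    (x v : EuclideanSpace ℝ (Fin 3)) :
    fderiv ℝ (fun x => ∫ y, f y / ‖x - y‖) x v = ∫ y, fderiv ℝ f y v / ‖x - y‖ := by
  have hk := locallyIntegrable_inv_norm_euclidean_three
  have h := hfc.hasFDerivAt_convolution_left (μ := volume) (ContinuousLinearMap.mul ℝ ℝ)
    (hf.of_le (by exact_mod_cast le_top)) hk x
  have h' := h.fderiv
  change fderiv ℝ (fun x => ∫ y, f y / ‖x - y‖) x = _ at h'
  rw [h']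
  have hc := hf.continuous_fderiv (by simp)
  have hex := (hfc.fderiv ℝ).convolutionExists_left
    ((ContinuousLinearMap.mul ℝ ℝ).precompL (EuclideanSpace ℝ (Fin 3))) hc hk x
  rw [convolution_def, ContinuousLinearMap.integral_apply hex]
  simp [div_eq_mul_inv]

lemma contDiff_fderiv_apply_const {E : Type*} [NormedAddCommGroup E] [NormedSpace ℝ E] {f : E → ℝ}
    (hf : ContDiff ℝ (⊤ : ℕ∞) f) (v : E) :
    ContDiff ℝ (⊤ : ℕ∞) (fun x => fderiv ℝ f x v) :=
  (hf.fderiv_right (m := (⊤ : ℕ∞)) (by simp)).clm_apply contDiff_const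

/-- Two integrations by parts against a compactly supported function. -/
lemma integral_mul_fderiv_fderiv {E : Type*} [NormedAddCommGroup E] [NormedSpace ℝ E]
    [FiniteDimensional ℝ E] [MeasurableSpace E] [BorelSpace E]
    {μ : Measure E} [μ.IsAddHaarMeasure] {k f : E → ℝ}
    (hk : ContDiff ℝ (⊤ : ℕ∞) k) (hf : ContDiff ℝ (⊤ : ℕ∞) f) (hfc : HasCompactSupport f) (v : E) :
    ∫ x, k x * fderiv ℝ (fun y => fderiv ℝ f y v) x v ∂μ =
      ∫ x, fderiv ℝ (fun y => fderiv ℝ k y v) x v * f x ∂μ := by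
  have hf1 := contDiff_fderiv_apply_const hf v
  have hf2 := contDiff_fderiv_apply_const hf1 v
  have hk1 := contDiff_fderiv_apply_const hk v
  have hk2 := contDiff_fderiv_apply_const hk1 v
  have hc1 := hfc.fderiv_apply (𝕜 := ℝ) v
  have hc2 := hc1.fderiv_apply (𝕜 := ℝ) v
  have hint : ∀ {a b : E → ℝ}, ContDiff ℝ (⊤ : ℕ∞) a → ContDiff ℝ (⊤ : ℕ∞) b →
      HasCompactSupport b → Integrable (fun x => a x * b x) μ := fun ha hb hbc =>
    (ha.continuous.mul hb.continuous).integrable_of_hasCompactSupport hbc.mul_left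
  have hd : ∀ {a : E → ℝ}, ContDiff ℝ (⊤ : ℕ∞) a → ∀ x, DifferentiableAt ℝ a x :=
    fun ha => ha.differentiable (by simp)
  rw [integral_mul_fderiv_eq_neg_fderiv_mul_of_integrable (hint hk1 hf1 hc1) (hint hk hf2 hc2)
      (hint hk hf1 hc1) (fun x _ => hd hk x) (fun x _ => hd hf1 x),
    integral_mul_fderiv_eq_neg_fderiv_mul_of_integrable (hint hk2 hf hfc) (hint hk1 hf1 hc1)
      (hint hk1 hf hfc) (fun x _ => hd hk1 x) (fun x _ => hd hf x), neg_neg]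

/-- The Laplacian of the regularized Newtonian kernel `c (1 + c² ‖x‖²) ^ (-1/2)` on `ℝ³`. -/
lemma sum_fderiv_fderiv_regularized_kernel (c : ℝ) (x : EuclideanSpace ℝ (Fin 3)) :
    ∑ s : Fin 3, fderiv ℝ (fun y => fderiv ℝ
        (fun z : EuclideanSpace ℝ (Fin 3) => c * (1 + c ^ 2 * ‖z‖ ^ 2) ^ (-1 / 2 : ℝ)) y
          (EuclideanSpace.single s 1)) x (EuclideanSpace.single s 1) =
      -(3 * c ^ 3 * (1 + c ^ 2 * ‖x‖ ^ 2) ^ (-5 / 2 : ℝ)) := by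
  have hD := fun (p : ℝ) (y : EuclideanSpace ℝ (Fin 3)) =>
    hasFDerivAt_one_add_mul_norm_sq_rpow (sq_nonneg c) p y
  have h1 : ∀ (s : Fin 3) (y : EuclideanSpace ℝ (Fin 3)), fderiv ℝ
        (fun z : EuclideanSpace ℝ (Fin 3) => c * (1 + c ^ 2 * ‖z‖ ^ 2) ^ (-1 / 2 : ℝ)) y
          (EuclideanSpace.single s 1) =
        -c ^ 3 * (y s * (1 + c ^ 2 * ‖y‖ ^ 2) ^ (-3 / 2 : ℝ)) := by
    intro s y
    rw [((hD (-1 / 2) y).const_mul c).fderiv]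
    norm_num [EuclideanSpace.inner_single_right]
    ring
  have h2 : ∀ s : Fin 3, fderiv ℝ (fun y : EuclideanSpace ℝ (Fin 3) =>
        -c ^ 3 * (y s * (1 + c ^ 2 * ‖y‖ ^ 2) ^ (-3 / 2 : ℝ))) x (EuclideanSpace.single s 1) =
        -c ^ 3 * (1 + c ^ 2 * ‖x‖ ^ 2) ^ (-3 / 2 : ℝ) +
          3 * c ^ 5 * (1 + c ^ 2 * ‖x‖ ^ 2) ^ (-5 / 2 : ℝ) * x s ^ 2 := by
    intro s
    have hp : HasFDerivAt (fun y : EuclideanSpace ℝ (Fin 3) => y s)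
        (EuclideanSpace.proj s : EuclideanSpace ℝ (Fin 3) →L[ℝ] ℝ) x :=
      (EuclideanSpace.proj s : EuclideanSpace ℝ (Fin 3) →L[ℝ] ℝ).hasFDerivAt
    have hpD : HasFDerivAt (fun y : EuclideanSpace ℝ (Fin 3) =>
        -c ^ 3 * (y s * (1 + c ^ 2 * ‖y‖ ^ 2) ^ (-3 / 2 : ℝ))) _ x :=
      (hp.mul (hD (-3 / 2) x)).const_mul (-c ^ 3)
    rw [hpD.fderiv]
    norm_num [EuclideanSpace.inner_single_right]
    ring
  have hpos : 0 < 1 + c ^ 2 * ‖x‖ ^ 2 := by positivity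
  simp only [h1, h2]
  rw [Finset.sum_add_distrib, Finset.sum_const, ← Finset.mul_sum, ← EuclideanSpace.real_norm_sq_eq,
    show (-3 / 2 : ℝ) = -5 / 2 + 1 by norm_num, Real.rpow_add_one hpos.ne']
  simp
  ring

/-- `-1 / (4π‖x‖)` is a fundamental solution of the Laplacian on `ℝ³`. -/
lemma integral_laplacian_div_norm {f : EuclideanSpace ℝ (Fin 3) → ℝ}
    (hf : ContDiff ℝ (⊤ : ℕ∞) f) (hfc : HasCompactSupport f) :
    ∫ x, (∑ s : Fin 3, fderiv ℝ (fun y => fderiv ℝ f y (EuclideanSpace.single s 1)) x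
      (EuclideanSpace.single s 1)) / ‖x‖ = -(4 * Real.pi) * f 0 := by
  set g : EuclideanSpace ℝ (Fin 3) → ℝ := fun x =>
    ∑ s : Fin 3, fderiv ℝ (fun y => fderiv ℝ f y (EuclideanSpace.single s 1)) x
      (EuclideanSpace.single s 1) with hg
  set k : ℝ → EuclideanSpace ℝ (Fin 3) → ℝ :=
    fun c z => c * (1 + c ^ 2 * ‖z‖ ^ 2) ^ (-1 / 2 : ℝ) with hk
  have hf2 := fun s : Fin 3 => contDiff_fderiv_apply_const (contDiff_fderiv_apply_const hf
    (EuclideanSpace.single s 1)) (EuclideanSpace.single s 1)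
  have hc2 := fun s : Fin 3 => (hfc.fderiv_apply (𝕜 := ℝ)
    (EuclideanSpace.single s 1)).fderiv_apply (𝕜 := ℝ) (EuclideanSpace.single s 1)
  have hw : ∀ (c : ℝ) (z : EuclideanSpace ℝ (Fin 3)), 0 < 1 + c ^ 2 * ‖z‖ ^ 2 :=
    fun c z => by positivity
  have hkc : ∀ c, ContDiff ℝ (⊤ : ℕ∞) (k c) := fun c =>
    contDiff_const.mul ((contDiff_const.add (contDiff_const.mul
      (contDiff_norm_sq ℝ))).rpow_const_of_ne fun z => (hw c z).ne')
  have hgcont : Continuous g := continuous_finsetSum _ fun s _ => (hf2 s).continuous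
  have hgint : Integrable (fun x => ‖x‖⁻¹ * g x) := by
    have hterm : ∀ s : Fin 3, Integrable (fun x : EuclideanSpace ℝ (Fin 3) => ‖x‖⁻¹ *
        fderiv ℝ (fun y => fderiv ℝ f y (EuclideanSpace.single s 1)) x
          (EuclideanSpace.single s 1)) := fun s =>
      locallyIntegrable_inv_norm_euclidean_three.integrable_smul_right_of_hasCompactSupport
        (hf2 s).continuous (hc2 s)
    simp only [hg, Finset.mul_sum]
    exact integrable_finsetSum _ fun s _ => hterm s
  have hibp : ∀ c, ∫ x, k c x * g x =
      ∫ x, -(3 * c ^ 3 * (1 + c ^ 2 * ‖x‖ ^ 2) ^ (-5 / 2 : ℝ)) * f x := by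
    intro c
    have hint : ∀ {a b : EuclideanSpace ℝ (Fin 3) → ℝ}, ContDiff ℝ (⊤ : ℕ∞) a →
        ContDiff ℝ (⊤ : ℕ∞) b → HasCompactSupport b → Integrable (fun x => a x * b x) :=
      fun ha hb hbc => (ha.continuous.mul hb.continuous).integrable_of_hasCompactSupport
        hbc.mul_left
    simp only [hg, Finset.mul_sum]
    rw [integral_finsetSum _ fun s _ => hint (hkc c) (hf2 s) (hc2 s)]
    simp only [integral_mul_fderiv_fderiv (hkc c) hf hfc]
    rw [← integral_finsetSum _ fun s _ => hint (contDiff_fderiv_apply_const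
      (contDiff_fderiv_apply_const (hkc c) _) _) hf hfc]
    simp only [← Finset.sum_mul, hk, sum_fderiv_fderiv_regularized_kernel]
  have hlim1 : Tendsto (fun c => ∫ x, k c x * g x) atTop (𝓝 (∫ x, ‖x‖⁻¹ * g x)) := by
    refine tendsto_integral_filter_of_dominated_convergence (fun x => ‖‖x‖⁻¹ * g x‖)
      (Eventually.of_forall fun c => ((hkc c).continuous.mul hgcont).aestronglyMeasurable)
      ?_ hgint.norm ?_
    · filter_upwards [eventually_gt_atTop 0] with c hc
      filter_upwards [compl_mem_ae_iff.mpr (measure_singleton (0 : EuclideanSpace ℝ (Fin 3)))]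
        with x hx
      have hx0 : 0 < ‖x‖ := norm_pos_iff.mpr hx
      rw [norm_mul (k c x) (g x), norm_mul ‖x‖⁻¹ (g x)]
      refine mul_le_mul_of_nonneg_right ?_ (norm_nonneg _)
      rw [Real.norm_of_nonneg (by positivity), Real.norm_of_nonneg (by positivity)]
      have hle : (1 + c ^ 2 * ‖x‖ ^ 2) ^ (-1 / 2 : ℝ) ≤ (c * ‖x‖)⁻¹ := by
        rw [show (-1 / 2 : ℝ) = -(1 / 2) by norm_num, Real.rpow_neg (hw c x).le,
          ← Real.sqrt_eq_rpow]
        gcongr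
        apply Real.le_sqrt_of_sq_le
        rw [mul_pow]
        linarith
      calc c * (1 + c ^ 2 * ‖x‖ ^ 2) ^ (-1 / 2 : ℝ) ≤ c * (c * ‖x‖)⁻¹ := by gcongr
        _ = ‖x‖⁻¹ := by field_simp
    · filter_upwards [compl_mem_ae_iff.mpr (measure_singleton (0 : EuclideanSpace ℝ (Fin 3)))]
        with x hx
      have hx0 : 0 < ‖x‖ := norm_pos_iff.mpr hx
      refine Tendsto.mul_const _ ?_
      have h0 : Tendsto (fun c : ℝ => (c⁻¹) ^ 2 + ‖x‖ ^ 2) atTop (𝓝 (0 ^ 2 + ‖x‖ ^ 2)) :=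
        (tendsto_inv_atTop_zero.pow 2).add_const _
      have h1 := h0.sqrt.inv₀ (by simp [hx0.ne', hx0.le])
      rw [zero_pow two_ne_zero, zero_add, Real.sqrt_sq hx0.le] at h1
      refine h1.congr' ?_
      filter_upwards [eventually_gt_atTop 0] with c hc
      rw [hk]
      simp only
      rw [show (-1 / 2 : ℝ) = -(1 / 2) by norm_num, Real.rpow_neg (hw c x).le,
        ← Real.sqrt_eq_rpow, show 1 + c ^ 2 * ‖x‖ ^ 2 = c ^ 2 * (c⁻¹ ^ 2 + ‖x‖ ^ 2) by field_simp,
        Real.sqrt_mul (by positivity), Real.sqrt_sq hc.le]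
      field_simp
  have hlim2 : Tendsto (fun c => ∫ x, k c x * g x) atTop (𝓝 (-(4 * Real.pi) * f 0)) := by
    have hpeak := (tendsto_integral_comp_smul_smul_of_integrable (μ := volume)
      (φ := fun x : EuclideanSpace ℝ (Fin 3) =>
        3 / (4 * Real.pi) * (1 + ‖x‖ ^ 2) ^ (-5 / 2 : ℝ))
      (fun x => by positivity) ?_ ?_ (hf.continuous.integrable_of_hasCompactSupport hfc)
      hf.continuous.continuousAt).const_mul (-(4 * Real.pi))
    · refine hpeak.congr fun c => ?_
      rw [hibp, ← integral_const_mul]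
      congr 1 with x
      simp only [finrank_euclideanSpace, Fintype.card_fin, norm_smul, mul_pow, Real.norm_eq_abs,
        sq_abs, smul_eq_mul]
      field_simp
    · rw [integral_const_mul, integral_one_add_norm_sq_rpow_euclidean_three]
      field_simp
    · have h0 : Tendsto (fun t : ℝ => 3 / (4 * Real.pi) * (1 + t ^ 2)⁻¹) atTop (𝓝 0) := by
        simpa using (tendsto_inv_atTop_zero.comp (tendsto_atTop_add_const_left atTop (1 : ℝ)
          (tendsto_pow_atTop (α := ℝ) two_ne_zero))).const_mul (3 / (4 * Real.pi))
      refine squeeze_zero (fun x => by positivity) (fun x => ?_)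
        (h0.comp tendsto_norm_cobounded_atTop)
      have hpos : 0 < 1 + ‖x‖ ^ 2 := by positivity
      have hle : ‖x‖ ^ 3 ≤ (1 + ‖x‖ ^ 2) ^ (3 / 2 : ℝ) := by
        calc ‖x‖ ^ 3 = (‖x‖ ^ 2) ^ (3 / 2 : ℝ) := by
              rw [← Real.rpow_natCast ‖x‖ 2, ← Real.rpow_mul (norm_nonneg x),
                ← Real.rpow_natCast ‖x‖ 3]
              norm_num
          _ ≤ _ := by gcongr; linarith
      simp only [finrank_euclideanSpace, Fintype.card_fin, Function.comp_apply]
      calc ‖x‖ ^ 3 * (3 / (4 * Real.pi) * (1 + ‖x‖ ^ 2) ^ (-5 / 2 : ℝ))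
          ≤ (1 + ‖x‖ ^ 2) ^ (3 / 2 : ℝ) *
              (3 / (4 * Real.pi) * (1 + ‖x‖ ^ 2) ^ (-5 / 2 : ℝ)) := by gcongr
        _ = 3 / (4 * Real.pi) *
              ((1 + ‖x‖ ^ 2) ^ (3 / 2 : ℝ) * (1 + ‖x‖ ^ 2) ^ (-5 / 2 : ℝ)) := by ring
        _ = 3 / (4 * Real.pi) * (1 + ‖x‖ ^ 2)⁻¹ := by
              rw [← Real.rpow_add hpos, ← Real.rpow_neg_one]
              norm_num
  simpa [div_eq_inv_mul] using tendsto_nhds_unique hlim1 hlim2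

/-- (First part of the paper's Lemma 3.)  Let `ρ : ℝ³ → ℝ` be smooth
with compact support and let `u x = −(1/(4π)) ∫ ρ y / ‖x − y‖ dy` be its Coulomb
potential.  Then `u` is twice differentiable and satisfies the Poisson equation
`Δu = Σ_s ∂²u/∂x_s² = ρ`. -/
theorem coulomb_potential_poisson (ρ : EuclideanSpace ℝ (Fin 3) → ℝ)
    (hρ : ContDiff ℝ (⊤ : ℕ∞) ρ) (hsupp : HasCompactSupport ρ)
    (u : EuclideanSpace ℝ (Fin 3) → ℝ)
    (hu : ∀ x, u x = -(1 / (4 * Real.pi)) * ∫ y, ρ y / ‖x - y‖) :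
    Differentiable ℝ u ∧ Differentiable ℝ (fderiv ℝ u) ∧
    ∀ x, ∑ s : Fin 3,
        fderiv ℝ (fun y => fderiv ℝ u y (EuclideanSpace.single s 1)) x
          (EuclideanSpace.single s 1) = ρ x := by
  obtain rfl : u = fun x => -(1 / (4 * Real.pi)) * ∫ y, ρ y / ‖x - y‖ := funext hu
  have hdiff : ∀ {f : EuclideanSpace ℝ (Fin 3) → ℝ}, ContDiff ℝ (⊤ : ℕ∞) f →
      HasCompactSupport f → Differentiable ℝ (fun x => ∫ y, f y / ‖x - y‖) := fun hf hfc =>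
    (contDiff_integral_div_norm hf hfc).differentiable (by simp)
  have hcont : ContDiff ℝ (⊤ : ℕ∞) (fun x => -(1 / (4 * Real.pi)) * ∫ y, ρ y / ‖x - y‖) :=
    contDiff_const.mul (contDiff_integral_div_norm hρ hsupp)
  refine ⟨hcont.differentiable (by simp),
    (hcont.fderiv_right (m := (⊤ : ℕ∞)) (by simp)).differentiable (by simp), fun x => ?_⟩
  have hD : ∀ {f : EuclideanSpace ℝ (Fin 3) → ℝ}, ContDiff ℝ (⊤ : ℕ∞) f →
      HasCompactSupport f → ∀ y v : EuclideanSpace ℝ (Fin 3),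
      fderiv ℝ (fun x => -(1 / (4 * Real.pi)) * ∫ y, f y / ‖x - y‖) y v =
        -(1 / (4 * Real.pi)) * ∫ z, fderiv ℝ f z v / ‖y - z‖ := by
    intro f hf hfc y v
    rw [fderiv_const_mul (hdiff hf hfc y), ← fderiv_integral_div_norm hf hfc y v]
    simp
  have hc1 := fun v => contDiff_fderiv_apply_const hρ v
  have hs1 := fun v => hsupp.fderiv_apply (𝕜 := ℝ) v
  simp only [hD hρ hsupp, hD (hc1 _) (hs1 _)]
  rw [← Finset.mul_sum, ← integral_finsetSum]
  · simp only [← Finset.sum_div]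
    rw [← integral_add_left_eq_self (μ := volume) _ x]
    have hmain := integral_laplacian_div_norm (f := fun z => ρ (x + z))
      (hρ.comp (contDiff_const.add contDiff_id))
      (hsupp.comp_homeomorph (Homeomorph.addLeft x))
    have h1 : ∀ v y : EuclideanSpace ℝ (Fin 3),
        fderiv ℝ (fun z => ρ (x + z)) y v = fderiv ℝ ρ (x + y) v :=
      fun v y => by rw [fderiv_comp_add_left]
    have h2 : ∀ v y : EuclideanSpace ℝ (Fin 3),
        fderiv ℝ (fun z => fderiv ℝ ρ (x + z) v) y v =
          fderiv ℝ (fun z => fderiv ℝ ρ z v) (x + y) v :=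
      fun v y => by rw [fderiv_comp_add_left (f := fun z => fderiv ℝ ρ z v)]
    simp only [h1, h2, add_zero] at hmain
    simp only [sub_add_cancel_left, norm_neg, hmain]
    field_simp
  · intro s _
    exact ((hs1 _).fderiv_apply (𝕜 := ℝ) _).convolutionExists_left (ContinuousLinearMap.mul ℝ ℝ)
      (contDiff_fderiv_apply_const (hc1 _) _).continuous
      locallyIntegrable_inv_norm_euclidean_three x
end
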